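/- Every aperiodic, irreducible interval exchange transformation with no connections is minimal, i.e. the orbit of every point of X is dense in X. -/

import Mathlib

open Set Topology MeasureTheory

/-- A set `S` is *admissible* for `T` if it is closed and discrete and `T`
restricted to the complement of `S` is a homeomorphism onto the complement of a
closed discrete set. -/
def Admissible {X : Type*} [TopologicalSpace X] (T : X → X) (S : Set X) : Prop :=
  IsClosed S ∧ DiscreteTopology ↥S ∧
    ∃ S' : Set X, IsClosed S' ∧ DiscreteTopology ↥S' ∧
      ∃ h : ↥(Sᶜ) ≃ₜ ↥(S'ᶜ), ∀ x : ↥(Sᶜ), (h x : X) = T (x : X)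

/-- The set of singularities of `T`: the minimal admissible set. -/
def Sing {X : Type*} [TopologicalSpace X] (T : X → X) : Set X :=
  ⋂₀ {S | Admissible T S}

/-- The image of a set, never applying `T` at singular points. -/
def img {X : Type*} [TopologicalSpace X] (T : X → X) (A : Set X) : Set X :=
  T '' (A \ Sing T)

/-- The preimage of a set under `T`, i.e. the image under `T⁻¹`. -/
def preimg {X : Type*} [TopologicalSpace X] (T : X → X) (A : Set X) : Set X :=
  {y | y ∉ Sing T ∧ T y ∈ A}

/-- The iterated image `T^k(A)`, `k ∈ ℤ`. -/
def iterImg {X : Type*} [TopologicalSpace X] (T : X → X) (k : ℤ) (A : Set X) : Set X :=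
  if 0 ≤ k then (img T)^[k.toNat] A else (preimg T)^[(-k).toNat] A

/-- The forward orbit of a point. -/
def forwardOrbit {X : Type*} [TopologicalSpace X] (T : X → X) (x : X) : Set X :=
  ⋃ n : ℕ, (img T)^[n] ({x} : Set X)

/-- The (two-sided) orbit of a point. -/
def orbit {X : Type*} [TopologicalSpace X] (T : X → X) (x : X) : Set X :=
  ⋃ k : ℤ, iterImg T k ({x} : Set X)

/-- `x` is periodic: `T^n(x) = x` for some `n ≥ 1`, all iterates being defined. -/
def IsPeriodicOrbit {X : Type*} [TopologicalSpace X] (T : X → X) (x : X) : Prop :=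
  ∃ n : ℕ, 1 ≤ n ∧ x ∈ (img T)^[n] ({x} : Set X)

/-- An eligible map: it admits an admissible set and preserves the measure `μ`
away from singularities. -/
def Eligible {X : Type*} [TopologicalSpace X] [MeasurableSpace X] (μ : Measure X)
    (T : X → X) : Prop :=
  (∃ S, Admissible T S) ∧
    ∀ A : Set X, MeasurableSet A → A ⊆ (Sing T)ᶜ → μ (T '' A) = μ A

/-- A finite union of bounded open intervals with pairwise disjoint closures. -/
def IsFiniteUnionOfIntervals (S : Set ℝ) : Prop :=
  ∃ (n : ℕ) (a b : Fin n → ℝ), (∀ i, a i < b i) ∧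
    S = ⋃ i, Ioo (a i) (b i) ∧
    Pairwise fun i j => Disjoint (Icc (a i) (b i)) (Icc (a j) (b j))

/-- `T` is a translation on each connected component of `X \ Sing T`. -/
def IsTranslationOnComponents (X : Set ℝ) (T : ↥X → ↥X) : Prop :=
  ∀ x y : ↥X, x ∉ Sing T → y ∈ connectedComponentIn ((Sing T)ᶜ) x →
    (T y : ℝ) - (y : ℝ) = (T x : ℝ) - (x : ℝ)

/-- An interval exchange transformation. -/
def IsIET (X : Set ℝ) (T : ↥X → ↥X) : Prop :=
  IsFiniteUnionOfIntervals X ∧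
    Eligible (MeasureTheory.Measure.comap (Subtype.val : ↥X → ℝ) volume) T ∧
    (Sing T).Finite ∧ IsTranslationOnComponents X T

/-- A nontrivial union of connected components of `X` is invariant. -/
def IETReducible (X : Set ℝ) (T : ↥X → ↥X) : Prop :=
  ∃ U : Set ↥X, U.Nonempty ∧ U ≠ univ ∧
    (∀ x ∈ U, connectedComponent x ⊆ U) ∧ img T U ⊆ U

section Admissible

variable {X : Type*} [TopologicalSpace X] {T : X → X}

lemma Admissible.continuousOn {S : Set X} (h : Admissible T S) : ContinuousOn T Sᶜ := by
  obtain ⟨-, -, S', -, -, e, he⟩ := h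
  rw [continuousOn_iff_continuous_domRestrict]
  have : Sᶜ.domRestrict T = fun x => (e x : X) := funext fun x => (he x).symm
  rw [this]
  exact continuous_subtype_val.comp e.continuous

lemma Admissible.injOn {S : Set X} (h : Admissible T S) : InjOn T Sᶜ := by
  obtain ⟨-, -, S', -, -, e, he⟩ := h
  intro x hx y hy hxy
  have : e ⟨x, hx⟩ = e ⟨y, hy⟩ := Subtype.ext (by rw [he, he]; exact hxy)
  exact congrArg Subtype.val (e.injective this)

lemma Admissible.isOpen_image {S : Set X} (h : Admissible T S) {U : Set X} (hU : IsOpen U) :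
    IsOpen (T '' (U ∩ Sᶜ)) := by
  obtain ⟨-, -, S', hS', -, e, he⟩ := h
  have : T '' (U ∩ Sᶜ) = Subtype.val '' (e '' (Subtype.val ⁻¹' U)) := by
    ext y
    constructor
    · rintro ⟨x, ⟨hxU, hxS⟩, rfl⟩
      exact ⟨e ⟨x, hxS⟩, ⟨⟨x, hxS⟩, hxU, rfl⟩, he _⟩
    · rintro ⟨_, ⟨x, hx, rfl⟩, rfl⟩
      exact ⟨x, ⟨hx, x.2⟩, (he x).symm⟩
  rw [this]
  exact hS'.isOpen_compl.isOpenMap_subtype_val _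
    (e.isOpenMap _ (hU.preimage continuous_subtype_val))

lemma Admissible.exists_image_eq {S : Set X} (h : Admissible T S) :
    ∃ S' : Set X, IsClosed S' ∧ DiscreteTopology ↥S' ∧ T '' Sᶜ = S'ᶜ := by
  obtain ⟨-, -, S', hS', hd, e, he⟩ := h
  refine ⟨S', hS', hd, ?_⟩
  ext y
  constructor
  · rintro ⟨x, hx, rfl⟩
    rw [← he ⟨x, hx⟩]
    exact (e ⟨x, hx⟩).2
  · intro hy
    refine ⟨e.symm ⟨y, hy⟩, (e.symm ⟨y, hy⟩).2, ?_⟩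
    rw [← he, e.apply_symm_apply]

lemma dense_compl_of_discreteTopology [∀ x : X, (𝓝[≠] x).NeBot] {S : Set X}
    (hS : DiscreteTopology ↥S) : Dense Sᶜ := by
  intro x
  by_cases hx : x ∈ S
  · have h := discreteTopology_subtype_iff.1 hS x hx
    rw [← disjoint_iff, Filter.disjoint_principal_right] at h
    rw [mem_closure_iff_frequently]
    have h' : ∃ᶠ y in 𝓝[≠] x, y ∈ Sᶜ := Filter.Eventually.frequently h
    exact h'.filter_mono nhdsWithin_le_nhds
  · exact subset_closure hx

lemma notMem_sing_iff {x : X} : x ∉ Sing T ↔ ∃ S, Admissible T S ∧ x ∉ S := by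
  simp [Sing]

lemma isClosed_sing : IsClosed (Sing T) := isClosed_sInter fun _ h => h.1

lemma continuousOn_compl_sing : ContinuousOn T (Sing T)ᶜ := by
  intro x hx
  obtain ⟨S, hS, hxS⟩ := notMem_sing_iff.1 hx
  exact (hS.continuousOn.continuousAt (hS.1.isOpen_compl.mem_nhds hxS)).continuousWithinAt

lemma isOpen_image_compl_sing {U : Set X} (hU : IsOpen U) : IsOpen (T '' (U ∩ (Sing T)ᶜ)) := by
  have : T '' (U ∩ (Sing T)ᶜ) = ⋃ S ∈ {S | Admissible T S}, T '' (U ∩ Sᶜ) := by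
    rw [Sing, compl_sInter, sUnion_image, inter_iUnion₂, image_iUnion₂]
  rw [this]
  exact isOpen_biUnion fun S hS => Admissible.isOpen_image hS hU

lemma injOn_compl_sing [T2Space X] [∀ x : X, (𝓝[≠] x).NeBot] : InjOn T (Sing T)ᶜ := by
  intro x hx y hy hxy
  by_contra hne
  obtain ⟨S₁, h₁, hx₁⟩ := notMem_sing_iff.1 hx
  obtain ⟨S₂, h₂, hy₂⟩ := notMem_sing_iff.1 hy
  obtain ⟨U, V, hU, hV, hxU, hyV, hUV⟩ := t2_separation hne
  have hW : T '' (V ∩ S₂ᶜ) ∈ 𝓝 (T x) :=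
    (h₂.isOpen_image hV).mem_nhds ⟨y, ⟨hyV, hy₂⟩, hxy.symm⟩
  have hc : ContinuousAt T x := h₁.continuousOn.continuousAt (h₁.1.isOpen_compl.mem_nhds hx₁)
  have hN : T ⁻¹' (T '' (V ∩ S₂ᶜ)) ∩ U ∈ 𝓝 x := Filter.inter_mem (hc hW) (hU.mem_nhds hxU)
  obtain ⟨x', hx'S, ⟨y', ⟨hy'V, hy'S⟩, he⟩, hx'U⟩ :=
    (dense_compl_of_discreteTopology h₂.2.1).inter_nhds_nonempty hN
  have : y' = x' := h₂.injOn hy'S hx'S he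
  exact disjoint_left.1 hUV hx'U (this ▸ hy'V)

end Admissible

section PartialIteration

variable {α : Type*} {f : α → α} {S : Set α}

/-- The image of `A` under `f`, never applying `f` on `S`. -/
def imageOff (f : α → α) (S A : Set α) : Set α := f '' (A \ S)

lemma mem_iterate_imageOff (n : ℕ) (a y : α) :
    y ∈ (imageOff f S)^[n] {a} ↔ y = f^[n] a ∧ ∀ i < n, f^[i] a ∉ S := by
  induction n generalizing y with
  | zero => simp
  | succ n ih =>
    rw [Function.iterate_succ_apply', imageOff]
    constructor
    · rintro ⟨z, ⟨hz, hzS⟩, rfl⟩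
      obtain ⟨rfl, hi⟩ := (ih z).1 hz
      refine ⟨(Function.iterate_succ_apply' f n a).symm, fun i hin => ?_⟩
      rcases Nat.lt_succ_iff_lt_or_eq.1 hin with h | rfl
      exacts [hi i h, hzS]
    · rintro ⟨rfl, hi⟩
      exact ⟨f^[n] a, ⟨(ih _).2 ⟨rfl, fun i h => hi i (by omega)⟩, hi n (by omega)⟩,
        (Function.iterate_succ_apply' f n a).symm⟩

lemma forall_iterate_notMem_of_infinite {a : α}
    (h : (⋃ n : ℕ, (imageOff f S)^[n] {a}).Infinite) (k : ℕ) : f^[k] a ∉ S := by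
  intro hk
  refine h (((finite_Iic k).image fun n => f^[n] a).subset ?_)
  intro y hy
  obtain ⟨n, hn⟩ := mem_iUnion.1 hy
  obtain ⟨rfl, hi⟩ := (mem_iterate_imageOff n a y).1 hn
  exact ⟨n, not_lt.1 fun hkn => hi k hkn hk, rfl⟩

lemma injective_iterate_of_not_periodic {a : α} (hf : InjOn f Sᶜ) (ha : ∀ k, f^[k] a ∉ S)
    (hp : ∀ n : ℕ, 1 ≤ n → a ∉ (imageOff f S)^[n] {a}) :
    Function.Injective fun k : ℕ => f^[k] a := by
  have key : ∀ j n : ℕ, f^[j] a = f^[j + n] a → a = f^[n] a := by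
    intro j n
    induction j with
    | zero => simp
    | succ j ih =>
      intro h
      rw [Nat.add_right_comm, Function.iterate_succ_apply', Function.iterate_succ_apply'] at h
      exact ih (hf (ha j) (ha (j + n)) h)
  have lt : ∀ j k : ℕ, j < k → f^[j] a ≠ f^[k] a := by
    intro j k hjk h
    obtain ⟨n, rfl⟩ := Nat.exists_eq_add_of_lt hjk
    rw [add_assoc] at h
    exact hp (n + 1) (by omega)
      ((mem_iterate_imageOff _ _ _).2 ⟨key j (n + 1) h, fun i _ => ha i⟩)
  intro j k h
  rcases lt_trichotomy j k with hlt | heq | hgt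
  exacts [(lt j k hlt h).elim, heq, (lt k j hgt h.symm).elim]

end PartialIteration

section Gaps

variable {X : Set ℝ}

/-- `f` is a translation along every segment of `X` that avoids `S`. -/
def TranslationOff (f : ↥X → ↥X) (S : Set ↥X) : Prop :=
  ∀ u v : ↥X, (∀ w ∈ uIcc (u : ℝ) v, ∃ z : ↥X, z ∉ S ∧ (z : ℝ) = w) →
    (f v : ℝ) - v = (f u : ℝ) - u

/-- The segment of length `δ` starting at `a` in direction `σ`, without its endpoints, lies
in `V`. -/
def IsGap (V : Set ↥X) (σ : ℝ) (a : ↥X) (δ : ℝ) : Prop :=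
  ∀ t, 0 < t → t < δ → ∃ v ∈ V, (v : ℝ) = a + σ * t

lemma TranslationOff.isGap_map {f : ↥X → ↥X} {S V : Set ↥X} (hf : TranslationOff f S)
    (hV : ∀ v ∈ V, v ∉ S → f v ∈ V) {σ δ : ℝ} (hσ : σ = 1 ∨ σ = -1) {a : ↥X} (ha : a ∉ S)
    (hgap : IsGap V σ a δ) (havoid : ∀ t, 0 < t → t < δ → ∀ e ∈ S, (e : ℝ) ≠ a + σ * t) :
    IsGap V σ (f a) δ := by
  intro t ht htδ
  obtain ⟨v, hvV, hv⟩ := hgap t ht htδ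
  have hvS : v ∉ S := fun h => havoid t ht htδ v h hv
  refine ⟨f v, hV v hvV hvS, ?_⟩
  have := hf a v fun w hw => by
    obtain ⟨s, hs0, hst, rfl⟩ : ∃ s, 0 ≤ s ∧ s ≤ t ∧ w = a + σ * s := by
      rw [hv] at hw
      rcases hσ with rfl | rfl
      · rw [uIcc_of_le (by linarith)] at hw
        exact ⟨w - a, by linarith [hw.1], by linarith [hw.2], by ring⟩
      · rw [uIcc_of_ge (by linarith)] at hw
        exact ⟨a - w, by linarith [hw.2], by linarith [hw.1], by ring⟩
    rcases hs0.eq_or_lt with rfl | hs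
    · exact ⟨a, ha, by simp⟩
    · obtain ⟨z, -, hz⟩ := hgap s hs (by linarith)
      exact ⟨z, fun h => havoid s hs (by linarith) z h hz, hz⟩
  linarith

lemma IsGap.separated {V : Set ↥X} {σ δ : ℝ} (hσ : σ = 1 ∨ σ = -1) {a b : ↥X}
    (ha : a ∉ V) (hb : b ∉ V) (hab : a ≠ b) (hga : IsGap V σ a δ) (hgb : IsGap V σ b δ) :
    δ ≤ dist (a : ℝ) b := by
  by_contra! hlt
  have hne : (a : ℝ) ≠ b := fun h => hab (Subtype.ext h)
  have key : ∀ c d : ↥X, d ∉ V → IsGap V σ c δ → ∀ t, 0 < t → t < δ → (d : ℝ) ≠ c + σ * t := by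
    intro c d hd hg t ht htδ h
    obtain ⟨v, hv, hv'⟩ := hg t ht htδ
    exact hd (Subtype.ext (h.trans hv'.symm) ▸ hv)
  rw [Real.dist_eq] at hlt
  obtain ⟨h1, h2⟩ := abs_lt.1 hlt
  rcases hne.lt_or_gt with h | h <;> rcases hσ with rfl | rfl
  · exact key a b hb hga (b - a) (by linarith) (by linarith) (by ring)
  · exact key b a ha hgb (b - a) (by linarith) (by linarith) (by ring)
  · exact key b a ha hgb (a - b) (by linarith) (by linarith) (by ring)
  · exact key a b hb hga (a - b) (by linarith) (by linarith) (by ring)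

/-- An infinite forward orbit cannot contain an endpoint of an invariant set `V`. -/
lemma TranslationOff.not_isGap (hX : Bornology.IsBounded X) {f : ↥X → ↥X} {S V : Set ↥X}
    (hf : TranslationOff f S) (hS : S.Finite) (hV : ∀ v ∈ V, v ∉ S → f v ∈ V)
    (hV' : ∀ v, v ∉ S → f v ∈ V → v ∈ V) {σ δ : ℝ} (hσ : σ = 1 ∨ σ = -1) {a : ↥X} (haV : a ∉ V)
    (haS : ∀ k, f^[k] a ∉ S) (hinj : Function.Injective fun k : ℕ => f^[k] a) (hδ : 0 < δ) :
    ¬ IsGap V σ a δ := by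
  intro hgap
  have hσ0 : σ ≠ 0 := by rcases hσ with rfl | rfl <;> norm_num
  have hσσ : σ * σ = 1 := by rcases hσ with rfl | rfl <;> norm_num
  have hkV : ∀ k, f^[k] a ∉ V := by
    intro k
    induction k with
    | zero => exact haV
    | succ k ih =>
      rw [Function.iterate_succ_apply']
      exact fun h => ih (hV' _ (haS k) h)
  let B : Set ℕ := {k | ∃ e ∈ S, ∃ s, 0 < s ∧ (e : ℝ) = f^[k] a + σ * s ∧
    IsGap V σ (f^[k] a) s}
  have hB : B.Finite := by
    have hch : ∀ k, ∃ e : ↥X, k ∈ B → e ∈ S ∧ ∃ s, 0 < s ∧ (e : ℝ) = f^[k] a + σ * s ∧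
        IsGap V σ (f^[k] a) s := by
      intro k
      by_cases hk : k ∈ B
      · obtain ⟨e, he⟩ := hk
        exact ⟨e, fun _ => he⟩
      · exact ⟨a, fun h => (hk h).elim⟩
    choose e he using hch
    refine Set.Finite.of_injOn (f := e) (t := S) (fun k hk => (he k hk).1) ?_ hS
    intro j hj k hk hjk
    obtain ⟨-, s, hs, hes, hgs⟩ := he j hj
    obtain ⟨-, r, hr, her, hgr⟩ := he k hk
    have heq : (f^[j] a : ℝ) + σ * s = f^[k] a + σ * r := by rw [← hes, ← her, hjk]
    rcases lt_trichotomy s r with h | rfl | h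
    · obtain ⟨v, hv, hv'⟩ := hgr (r - s) (by linarith) (by linarith)
      exact (hkV j (Subtype.ext (a2 := f^[j] a) (hv'.trans (by linarith)) ▸ hv)).elim
    · exact hinj (Subtype.ext (by linarith))
    · obtain ⟨v, hv, hv'⟩ := hgs (s - r) (by linarith) (by linarith)
      exact (hkV k (Subtype.ext (a2 := f^[k] a) (hv'.trans (by linarith)) ▸ hv)).elim
  have hstep : ∀ k, k ∉ B → ∀ η, IsGap V σ (f^[k] a) η → IsGap V σ (f^[k + 1] a) η := by
    intro k hk η hη
    rw [Function.iterate_succ_apply']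
    refine hf.isGap_map hV hσ (haS k) hη fun t ht htη e he het => hk ?_
    exact ⟨e, he, t, ht, het, fun r hr hrt => hη r hr (hrt.trans htη)⟩
  have hpos : ∀ k, ∃ η, 0 < η ∧ IsGap V σ (f^[k] a) η := by
    intro k
    induction k with
    | zero => exact ⟨δ, hδ, hgap⟩
    | succ k ih =>
      obtain ⟨η, hη, hg⟩ := ih
      obtain ⟨ρ, hρ, hρS⟩ : ∃ ρ > 0, ∀ e ∈ S, ρ ≤ dist (e : ℝ) (f^[k] a) := by
        rcases S.eq_empty_or_nonempty with rfl | hne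
        · exact ⟨1, one_pos, by simp⟩
        · obtain ⟨e₀, he₀, hmin⟩ :=
            hS.isCompact.exists_isMinOn hne (f := fun e : ↥X => dist (e : ℝ) (f^[k] a))
              (by fun_prop)
          refine ⟨dist (e₀ : ℝ) (f^[k] a), dist_pos.2 fun h => haS k ?_, fun e he => hmin he⟩
          rw [← Subtype.ext h]
          exact he₀
      refine ⟨min η ρ, lt_min hη hρ, ?_⟩
      rw [Function.iterate_succ_apply']
      refine hf.isGap_map hV hσ (haS k)
        (fun t ht h => hg t ht (h.trans_le (min_le_left _ _))) ?_
      intro t ht htm e he het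
      have h1 := hρS e he
      have h2 : dist (e : ℝ) (f^[k] a) = t := by
        rw [Real.dist_eq, het, add_sub_cancel_left, abs_mul, abs_of_pos ht]
        rcases hσ with rfl | rfl <;> simp
      have h3 := htm.trans_le (min_le_right η ρ)
      linarith
  obtain ⟨N, hN⟩ := hB.bddAbove
  obtain ⟨η, hη, hgN⟩ := hpos (N + 1)
  have hall : ∀ k, IsGap V σ (f^[N + 1 + k] a) η := by
    intro k
    induction k with
    | zero => exact hgN
    | succ k ih =>
      refine hstep (N + 1 + k) (fun h => ?_) η ih
      have := hN h
      omega
  obtain ⟨c, -, φ, hφ, hlim⟩ :=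
    tendsto_subseq_of_bounded hX (x := fun k => (f^[N + 1 + k] a : ℝ)) fun k => Subtype.coe_prop _
  obtain ⟨M, hM⟩ := Metric.cauchySeq_iff.1 hlim.cauchySeq η hη
  have hsep := IsGap.separated hσ (hkV (N + 1 + φ M)) (hkV (N + 1 + φ (M + 1)))
    (fun h => by
      have h1 := hinj h
      have h2 : φ M < φ (M + 1) := hφ (Nat.lt_succ_self M)
      omega) (hall _) (hall _)
  have hclose := hM M le_rfl (M + 1) (Nat.le_succ M)
  simp only [Function.comp_apply] at hclose
  linarith

lemma exists_lift_of_mem_nhds (hX : IsOpen X) {a : ↥X} {U : Set ↥X} (hU : U ∈ 𝓝 a) :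
    ∃ ε > 0, ∀ w : ℝ, dist w a < ε → ∃ z ∈ U, (z : ℝ) = w := by
  obtain ⟨ε, hε, h⟩ := Metric.mem_nhds_iff.1 (hX.isOpenMap_subtype_val.image_mem_nhds hU)
  exact ⟨ε, hε, fun w hw => h hw⟩

/-- An open set without endpoints in `X` is closed in `X`. -/
lemma isClosed_of_forall_not_isGap (hX : IsOpen X) {V : Set ↥X} (hV : IsOpen V)
    (h : ∀ a ∉ V, ∀ σ : ℝ, σ = 1 ∨ σ = -1 → ∀ δ > 0, ¬ IsGap V σ a δ) : IsClosed V := by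
  rw [← isOpen_compl_iff, isOpen_iff_mem_nhds]
  intro a ha
  obtain ⟨ε, hε, hlift⟩ := exists_lift_of_mem_nhds hX (a := a) Filter.univ_mem
  refine Filter.mem_of_superset (Metric.ball_mem_nhds a hε) fun v hva hvV => ?_
  rw [Metric.mem_ball, Subtype.dist_eq, Real.dist_eq] at hva
  have hne : (v : ℝ) ≠ a := fun h => ha (Subtype.ext h ▸ hvV)
  obtain ⟨σ, L, hσ, hL, haL⟩ : ∃ σ L : ℝ, (σ = 1 ∨ σ = -1) ∧ 0 < L ∧ (a : ℝ) = v + σ * L := by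
    rcases hne.lt_or_gt with h | h
    · exact ⟨1, a - v, Or.inl rfl, by linarith, by ring⟩
    · exact ⟨-1, v - a, Or.inr rfl, by linarith, by ring⟩
  have hLε : L < ε := by
    have : |(v : ℝ) - a| = L := by
      rw [haL, sub_add_cancel_left, abs_neg, abs_mul, abs_of_pos hL]
      rcases hσ with rfl | rfl <;> simp
    linarith
  let Q : Set ℝ := {t | 0 ≤ t ∧ ¬ ∃ y ∈ V, (y : ℝ) = v + σ * t}
  have hQ : IsClosed Q := by
    have hO : IsOpen {t : ℝ | ∃ y ∈ V, (y : ℝ) = v + σ * t} :=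
      (hX.isOpenMap_subtype_val V hV).preimage (f := fun t : ℝ => (v : ℝ) + σ * t) (by fun_prop)
    exact isClosed_Ici.inter hO.isClosed_compl
  have hLQ : L ∈ Q :=
    ⟨hL.le, fun ⟨y, hy, hy'⟩ => ha (Subtype.ext (a1 := y) (hy'.trans haL.symm) ▸ hy)⟩
  have hbdd : BddBelow Q := ⟨0, fun t ht => ht.1⟩
  have hmem := hQ.csInf_mem ⟨L, hLQ⟩ hbdd
  set r := sInf Q with hr
  have hrL : r ≤ L := csInf_le hbdd hLQ
  have hr0 : 0 < r := hmem.1.lt_of_ne fun h0 => hmem.2 ⟨v, hvV, by rw [← h0]; ring⟩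
  obtain ⟨d, -, hd⟩ := hlift (v + σ * r) (by
    rw [Real.dist_eq, haL, show (v : ℝ) + σ * r - (v + σ * L) = σ * (r - L) by ring, abs_mul,
      abs_of_nonpos (by linarith : r - L ≤ 0)]
    rcases hσ with rfl | rfl <;> simp <;> linarith)
  refine h d (fun hdV => hmem.2 ⟨d, hdV, hd⟩) (-σ) (by rcases hσ with rfl | rfl <;> simp) r hr0 ?_
  intro t ht htr
  by_contra hno
  have : r - t ∈ Q := ⟨by linarith, fun ⟨y, hy, hy'⟩ => hno ⟨y, hy, by rw [hy', hd]; ring⟩⟩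
  have := csInf_le hbdd this
  linarith

end Gaps

section FiniteUnion

variable {X : Set ℝ}

lemma IsFiniteUnionOfIntervals.isOpen (h : IsFiniteUnionOfIntervals X) : IsOpen X := by
  obtain ⟨n, a, b, -, rfl, -⟩ := h
  exact isOpen_iUnion fun i => isOpen_Ioo

lemma IsFiniteUnionOfIntervals.isBounded (h : IsFiniteUnionOfIntervals X) :
    Bornology.IsBounded X := by
  obtain ⟨n, a, b, -, rfl, -⟩ := h
  exact Bornology.isBounded_iUnion.2 fun i => Metric.isBounded_Ioo _ _

lemma IsFiniteUnionOfIntervals.finite_closure_diff (h : IsFiniteUnionOfIntervals X) :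
    (closure X \ X).Finite := by
  obtain ⟨n, a, b, hab, rfl, -⟩ := h
  refine ((finite_range a).union (finite_range b)).subset ?_
  rintro x ⟨hx, hxX⟩
  rw [closure_iUnion_of_finite] at hx
  obtain ⟨i, hi⟩ := mem_iUnion.1 hx
  rw [closure_Ioo (hab i).ne] at hi
  rcases hi.1.eq_or_lt with h1 | h1
  · exact Or.inl ⟨i, h1⟩
  rcases hi.2.eq_or_lt with h2 | h2
  · exact Or.inr ⟨i, h2.symm⟩
  exact (hxX (mem_iUnion.2 ⟨i, h1, h2⟩)).elim

end FiniteUnion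

lemma IsOpen.neBot_nhdsNE_subtype {X : Set ℝ} (hX : IsOpen X) (x : ↥X) : (𝓝[≠] x).NeBot := by
  rw [← mem_closure_iff_nhdsWithin_neBot, mem_closure_iff_nhds]
  intro U hU
  obtain ⟨ε, hε, h⟩ := exists_lift_of_mem_nhds hX hU
  obtain ⟨z, hz, hzx⟩ := h (x + ε / 2) (by
    rw [Real.dist_eq, add_sub_cancel_left, abs_of_pos] <;> linarith)
  refine ⟨z, hz, fun h => ?_⟩
  rw [mem_singleton_iff.1 h] at hzx
  linarith

section InverseTranslation

variable {X : Set ℝ} {T G : ↥X → ↥X} {S S' : Set ↥X}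

lemma isPreconnected_segment {u v : ↥X}
    (h : ∀ w ∈ uIcc (u : ℝ) v, ∃ z : ↥X, z ∉ S ∧ (z : ℝ) = w) :
    IsPreconnected (Subtype.val ⁻¹' uIcc (u : ℝ) v : Set ↥X) := by
  rw [← IsInducing.subtypeVal.isPreconnected_image, image_preimage_eq_of_subset]
  · exact isPreconnected_uIcc
  · intro w hw
    obtain ⟨z, -, rfl⟩ := h w hw
    exact ⟨z, rfl⟩

lemma segment_subset_compl {u v : ↥X}
    (h : ∀ w ∈ uIcc (u : ℝ) v, ∃ z : ↥X, z ∉ S ∧ (z : ℝ) = w) :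
    (Subtype.val ⁻¹' uIcc (u : ℝ) v : Set ↥X) ⊆ Sᶜ := by
  intro w hw
  obtain ⟨z, hz, hzw⟩ := h w hw
  rwa [Subtype.ext hzw] at hz

lemma IsTranslationOnComponents.translationOff (hT : IsTranslationOnComponents X T) :
    TranslationOff T (Sing T) := by
  intro u v h
  have hsub := segment_subset_compl h
  exact hT u v (hsub left_mem_uIcc)
    ((isPreconnected_segment h).subset_connectedComponentIn left_mem_uIcc hsub right_mem_uIcc)

lemma IsTranslationOnComponents.translationOff_inverse (hT : IsTranslationOnComponents X T)
    (hG : ContinuousOn G S'ᶜ) (hGS : ∀ y ∉ S', G y ∉ Sing T) (hTG : ∀ y ∉ S', T (G y) = y) :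
    TranslationOff G S' := by
  intro u v h
  have hsub := segment_subset_compl h
  have hu := hsub (left_mem_uIcc : (u : ℝ) ∈ uIcc (u : ℝ) v)
  have hv := hsub (right_mem_uIcc : (v : ℝ) ∈ uIcc (u : ℝ) v)
  have hc := (isPreconnected_segment h).image G (hG.mono hsub)
  have hmem := hc.subset_connectedComponentIn (F := (Sing T)ᶜ) (mem_image_of_mem G left_mem_uIcc)
    (by rintro _ ⟨z, hz, rfl⟩; exact hGS z (hsub hz)) (mem_image_of_mem G right_mem_uIcc)
  have := hT (G u) (G v) (hGS u hu) hmem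
  rw [hTG u hu, hTG v hv] at this
  linarith

/-- If a partially defined translation omits a closed discrete set of values, then this set is
finite provided that the domain has finitely many endpoints. -/
lemma finite_of_translationOff_inverse (hX : IsOpen X) (hfr : (closure X \ X).Finite)
    (hS : S.Finite) (hSc : IsClosed S) (hd : DiscreteTopology ↥S')
    (hT : TranslationOff T S) (hG : TranslationOff G S')
    (hTS : ∀ x ∉ S, T x ∉ S') (hTG : ∀ y ∉ S', T (G y) = y) : S'.Finite := by
  have hex : ∀ s : ↥S', ∃ p : ℝ, ∃ ε > 0, ∀ t, 0 < t → t < ε →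
      ∃ y, y ∉ S' ∧ (y : ℝ) = (s : ↥X) + t ∧ (G y : ℝ) = p + t := by
    rintro ⟨s, hs⟩
    have hiso := discreteTopology_subtype_iff.1 hd s hs
    rw [← disjoint_iff, Filter.disjoint_principal_right,
      mem_nhdsWithin_iff_exists_mem_nhds_inter]
      at hiso
    obtain ⟨U, hU, hUS⟩ := hiso
    obtain ⟨ε, hε, hlift⟩ := exists_lift_of_mem_nhds hX hU
    have hy : ∀ t, 0 < t → t < ε → ∃ y, y ∉ S' ∧ (y : ℝ) = s + t := by
      intro t ht htε
      obtain ⟨y, hyU, hy⟩ := hlift (s + t) (by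
        rwa [Real.dist_eq, add_sub_cancel_left, abs_of_pos ht])
      refine ⟨y, hUS ⟨hyU, fun h => ?_⟩, hy⟩
      rw [mem_singleton_iff.1 h] at hy
      linarith
    obtain ⟨y₀, -, hy₀⟩ := hy (ε / 2) (by linarith) (by linarith)
    refine ⟨G y₀ - ε / 2, ε, hε, fun t ht htε => ?_⟩
    obtain ⟨y, hyS, hyt⟩ := hy t ht htε
    refine ⟨y, hyS, hyt, ?_⟩
    have := hG y₀ y fun w hw => by
      rw [hy₀, hyt] at hw
      have hw1 : s < w := lt_of_lt_of_le (lt_min (by linarith) (by linarith)) hw.1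
      have hw2 : w < s + ε := lt_of_le_of_lt hw.2 (max_lt (by linarith) (by linarith))
      obtain ⟨z, hz, hz'⟩ := hy (w - s) (by linarith) (by linarith)
      exact ⟨z, hz, by rw [hz']; ring⟩
    linarith
  choose p ε hε hp using hex
  have hmaps : ∀ s, p s ∈ (closure X \ X) ∪ Subtype.val '' S := by
    intro s
    by_contra hno
    rw [mem_union, not_or] at hno
    have hcl : p s ∈ closure X := by
      rw [Metric.mem_closure_iff]
      intro η hη
      have hm : 0 < min η (ε s) := lt_min hη (hε s)
      obtain ⟨y, -, -, hy⟩ := hp s (min η (ε s) / 2) (by linarith)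
        (by linarith [min_le_right η (ε s)])
      refine ⟨G y, (G y).2, ?_⟩
      rw [hy, dist_comm, Real.dist_eq, add_sub_cancel_left, abs_of_pos (by linarith)]
      linarith [min_le_left η (ε s)]
    have hpX : p s ∈ X := by
      by_contra h
      exact hno.1 ⟨hcl, h⟩
    have hpS : (⟨p s, hpX⟩ : ↥X) ∉ S := fun h => hno.2 ⟨_, h, rfl⟩
    obtain ⟨ρ, hρ, hlift⟩ := exists_lift_of_mem_nhds hX (hSc.isOpen_compl.mem_nhds hpS)
    have hm : 0 < min ρ (ε s) := lt_min hρ (hε s)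
    obtain ⟨y, hyS, hy, hGy⟩ := hp s (min ρ (ε s) / 2) (by linarith)
      (by linarith [min_le_right ρ (ε s)])
    have := hT ⟨p s, hpX⟩ (G y) fun w hw => by
      simp only [hGy] at hw
      rw [uIcc_of_le (by linarith)] at hw
      obtain ⟨z, hz, hz'⟩ := hlift w (by
        rw [Real.dist_eq, abs_lt]
        constructor <;> linarith [hw.1, hw.2, min_le_left ρ (ε s)])
      exact ⟨z, hz, hz'⟩
    rw [hTG y hyS, hGy, hy] at this
    apply hTS _ hpS
    rw [Subtype.ext (a1 := T ⟨p s, hpX⟩) (a2 := s.1) (by linarith)]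
    exact s.2
  have hinj : Function.Injective p := by
    intro s r hsr
    have hm : 0 < min (ε s) (ε r) := lt_min (hε s) (hε r)
    obtain ⟨y, hyS, hy, hGy⟩ := hp s (min (ε s) (ε r) / 2) (by linarith)
      (by linarith [min_le_left (ε s) (ε r)])
    obtain ⟨z, hzS, hz, hGz⟩ := hp r (min (ε s) (ε r) / 2) (by linarith)
      (by linarith [min_le_right (ε s) (ε r)])
    have hG : G y = G z := Subtype.ext (by rw [hGy, hGz, hsr])
    have hyz : y = z := by rw [← hTG y hyS, ← hTG z hzS, hG]
    rw [hyz] at hy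
    exact Subtype.ext (Subtype.ext (by linarith))
  have hfin := hfr.union (hS.image Subtype.val)
  have : Finite ↥S' := by
    have := hfin.to_subtype
    exact Finite.of_injective (fun s => (⟨p s, hmaps s⟩ : ↥((closure X \ X) ∪ Subtype.val '' S)))
      fun s r h => hinj (congrArg Subtype.val h)
  exact toFinite S'

end InverseTranslation

section Orbit

variable {X : Type*} [TopologicalSpace X] {T : X → X}

lemma orbit_eq (x : X) :
    orbit T x = (⋃ n : ℕ, (img T)^[n] {x}) ∪ ⋃ n : ℕ, (preimg T)^[n] {x} := by
  ext y
  simp only [orbit, iterImg, mem_iUnion, mem_union]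
  constructor
  · rintro ⟨k, hk⟩
    split_ifs at hk
    exacts [Or.inl ⟨_, hk⟩, Or.inr ⟨_, hk⟩]
  · rintro (⟨n, hn⟩ | ⟨n, hn⟩)
    · exact ⟨n, by simpa using hn⟩
    · rcases Nat.eq_zero_or_pos n with rfl | hpos
      · exact ⟨0, by simpa using hn⟩
      · refine ⟨-n, ?_⟩
        rw [if_neg (by omega)]
        simpa using hn

lemma self_mem_orbit (x : X) : x ∈ orbit T x := by
  rw [orbit_eq]
  exact Or.inl (mem_iUnion.2 ⟨0, rfl⟩)

lemma map_mem_orbit {x y : X} (hy : y ∈ orbit T x) (hyS : y ∉ Sing T) : T y ∈ orbit T x := by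
  rw [orbit_eq] at hy ⊢
  simp only [mem_union, mem_iUnion] at hy ⊢
  have himg : ∀ n, y ∈ (img T)^[n] {x} → T y ∈ (img T)^[n + 1] {x} := by
    intro n hn
    rw [Function.iterate_succ_apply']
    exact ⟨y, ⟨hn, hyS⟩, rfl⟩
  rcases hy with ⟨n, hn⟩ | ⟨n, hn⟩
  · exact Or.inl ⟨n + 1, himg n hn⟩
  · cases n with
    | zero => exact Or.inl ⟨1, himg 0 hn⟩
    | succ n =>
      rw [Function.iterate_succ_apply'] at hn
      exact Or.inr ⟨n, hn.2⟩

lemma mem_orbit_of_map_mem (hT : InjOn T (Sing T)ᶜ) {x y : X} (hy : T y ∈ orbit T x)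
    (hyS : y ∉ Sing T) : y ∈ orbit T x := by
  rw [orbit_eq] at hy ⊢
  simp only [mem_union, mem_iUnion] at hy ⊢
  have hpre : ∀ n, T y ∈ (preimg T)^[n] {x} → y ∈ (preimg T)^[n + 1] {x} := by
    intro n hn
    rw [Function.iterate_succ_apply']
    exact ⟨hyS, hn⟩
  rcases hy with ⟨n, hn⟩ | ⟨n, hn⟩
  · cases n with
    | zero => exact Or.inr ⟨1, hpre 0 hn⟩
    | succ n =>
      rw [Function.iterate_succ_apply'] at hn
      obtain ⟨z, ⟨hz, hzS⟩, hzy⟩ := hn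
      exact Or.inl ⟨n, hT hzS hyS hzy ▸ hz⟩
  · exact Or.inr ⟨n + 1, hpre n hn⟩

lemma mem_iterate_preimg_iff (n : ℕ) (x y : X) :
    y ∈ (preimg T)^[n] {x} ↔ x = T^[n] y ∧ ∀ i < n, T^[i] y ∉ Sing T := by
  induction n generalizing y with
  | zero => simp [eq_comm]
  | succ n ih =>
    rw [Function.iterate_succ_apply', preimg, mem_ofPred_eq, ih, Function.iterate_succ_apply]
    constructor
    · rintro ⟨h0, h1, h2⟩
      refine ⟨h1, fun i hi => ?_⟩
      cases i with
      | zero => exact h0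
      | succ i => exact h2 i (by omega)
    · rintro ⟨h1, h2⟩
      exact ⟨h2 0 (by omega), h1, fun i hi => h2 (i + 1) (by omega)⟩

lemma preimg_eq_imageOff {G : X → X} {S' : Set X} (hTS : ∀ x ∉ Sing T, T x ∉ S')
    (hGT : ∀ x ∉ Sing T, G (T x) = x) (hGS : ∀ y ∉ S', G y ∉ Sing T)
    (hTG : ∀ y ∉ S', T (G y) = y) : preimg T = imageOff G S' := by
  ext A y
  constructor
  · rintro ⟨hy, hyA⟩
    exact ⟨T y, ⟨hyA, hTS y hy⟩, hGT y hy⟩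
  · rintro ⟨z, ⟨hzA, hzS⟩, rfl⟩
    exact ⟨hGS z hzS, by rwa [hTG z hzS]⟩

lemma closure_orbit_invariant (hT : InjOn T (Sing T)ᶜ) (x : X) {y : X} (hy : y ∉ Sing T) :
    T y ∈ closure (orbit T x) ↔ y ∈ closure (orbit T x) := by
  constructor
  · intro h
    rw [mem_closure_iff] at h ⊢
    intro U hU hyU
    obtain ⟨_, ⟨z, ⟨hzU, hzS⟩, rfl⟩, hz⟩ :=
      h _ (isOpen_image_compl_sing hU) ⟨y, ⟨hyU, hy⟩, rfl⟩
    exact ⟨z, hzU, mem_orbit_of_map_mem hT hz hzS⟩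
  · intro h
    rw [mem_closure_iff_nhds] at h ⊢
    intro W hW
    have hN := isClosed_sing.isOpen_compl.mem_nhds hy
    obtain ⟨z, ⟨hzW, hzS⟩, hz⟩ :=
      h _ (Filter.inter_mem ((continuousOn_compl_sing.continuousAt hN) hW) hN)
    exact ⟨T z, hzW, map_mem_orbit hz hzS⟩

end Orbit

/-- every aperiodic, irreducible IET with no connections is minimal. -/
theorem iet_minimal (X : Set ℝ) (T : ↥X → ↥X) (hIET : IsIET X T)
    (haperiodic : ∀ x : ↥X, ¬ IsPeriodicOrbit T x)
    (hirreducible : ¬ IETReducible X T)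
    (hnoconn : ∀ x : ↥X, ¬ ((orbit T x).Finite ∧ ¬ IsPeriodicOrbit T x)) :
    ∀ x : ↥X, Dense (orbit T x) := by
  intro x
  obtain ⟨hX, ⟨⟨S₀, hS₀⟩, -⟩, hfin, htrans⟩ := hIET
  have hne := hX.isOpen.neBot_nhdsNE_subtype
  have hinj : InjOn T (Sing T)ᶜ := injOn_compl_sing
  have : Nonempty ↥X := ⟨x⟩
  let S' : Set ↥X := (T '' (Sing T)ᶜ)ᶜ
  let G : ↥X → ↥X := Function.invFunOn T (Sing T)ᶜ
  have hG : ∀ y ∉ S', G y ∉ Sing T ∧ T (G y) = y := fun y hy =>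
    Function.invFunOn_pos (not_not.1 hy)
  have hGS : ∀ y ∉ S', G y ∉ Sing T := fun y hy => (hG y hy).1
  have hTG : ∀ y ∉ S', T (G y) = y := fun y hy => (hG y hy).2
  have hTS : ∀ y ∉ Sing T, T y ∉ S' := fun y hy h => h ⟨y, hy, rfl⟩
  have hGT : ∀ y ∉ Sing T, G (T y) = y := fun y hy =>
    hinj (hGS _ (hTS y hy)) hy (hTG _ (hTS y hy))
  have hGinj : InjOn G S'ᶜ := fun y hy z hz h => by rw [← hTG y hy, ← hTG z hz, h]
  have hGcont : ContinuousOn G S'ᶜ := by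
    rw [continuousOn_iff']
    intro U hU
    refine ⟨T '' (U ∩ (Sing T)ᶜ), isOpen_image_compl_sing hU, ?_⟩
    ext y
    constructor
    · rintro ⟨hyU, hy⟩
      exact ⟨⟨G y, ⟨hyU, hGS y hy⟩, hTG y hy⟩, hy⟩
    · rintro ⟨⟨z, ⟨hzU, hzS⟩, rfl⟩, hy⟩
      exact ⟨by rwa [mem_preimage, hGT z hzS], hy⟩
  have hS'disc : DiscreteTopology ↥S' := by
    obtain ⟨S₁, -, hd, himg⟩ := hS₀.exists_image_eq
    refine DiscreteTopology.of_subset hd (compl_subset_comm.1 ?_)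
    rw [← himg]
    exact image_mono (compl_subset_compl.2 (sInter_subset_of_mem hS₀))
  have hTt := htrans.translationOff
  have hGt := htrans.translationOff_inverse hGcont hGS hTG
  have hS'fin : S'.Finite :=
    finite_of_translationOff_inverse hX.isOpen hX.finite_closure_diff hfin isClosed_sing
      hS'disc hTt hGt hTS hTG
  have hpre := preimg_eq_imageOff hTS hGT hGS hTG
  by_contra hdense
  let V : Set ↥X := (closure (orbit T x))ᶜ
  have hV : ∀ y ∉ Sing T, (T y ∈ V ↔ y ∈ V) := fun y hy =>
    not_congr (closure_orbit_invariant hinj x hy)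
  have hVG : ∀ y ∉ S', (G y ∈ V ↔ y ∈ V) := fun y hy => by
    rw [← hV _ (hGS y hy), hTG y hy]
  have hgap : ∀ a ∉ V, ∀ σ : ℝ, σ = 1 ∨ σ = -1 → ∀ δ > 0, ¬ IsGap V σ a δ := by
    intro a ha σ hσ δ hδ
    have hinf : (orbit T a).Infinite := fun h => hnoconn a ⟨h, haperiodic a⟩
    rw [orbit_eq, infinite_union] at hinf
    rcases hinf with hinf | hinf
    · have haS := forall_iterate_notMem_of_infinite (f := T) (S := Sing T) hinf
      refine hTt.not_isGap hX.isBounded hfin (fun v hv hvS => (hV v hvS).2 hv)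
        (fun v hvS hv => (hV v hvS).1 hv) hσ ha haS ?_ hδ
      exact injective_iterate_of_not_periodic hinj haS fun n hn h => haperiodic a ⟨n, hn, h⟩
    · rw [hpre] at hinf
      have haS := forall_iterate_notMem_of_infinite hinf
      refine hGt.not_isGap hX.isBounded hS'fin (fun v hv hvS => (hVG v hvS).2 hv)
        (fun v hvS hv => (hVG v hvS).1 hv) hσ ha haS ?_ hδ
      refine injective_iterate_of_not_periodic hGinj haS fun n hn h => haperiodic a ⟨n, hn, ?_⟩
      rw [← hpre, mem_iterate_preimg_iff] at h
      exact (mem_iterate_imageOff n a a).2 h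
  have hVopen : IsOpen V := isClosed_closure.isOpen_compl
  have hVclopen : IsClopen V := ⟨isClosed_of_forall_not_isGap hX.isOpen hVopen hgap, hVopen⟩
  refine hirreducible ⟨V, ?_, ?_, fun y hy => hVclopen.connectedComponent_subset hy, ?_⟩
  · rw [nonempty_compl]
    exact fun h => hdense (dense_iff_closure_eq.2 h)
  · intro h
    have hx : x ∈ V := h ▸ mem_univ x
    exact hx (subset_closure (self_mem_orbit x))
  · rintro _ ⟨y, ⟨hy, hyS⟩, rfl⟩
    exact (hV y hyS).2 hy
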